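/- Let d ≥ 1 be an integer and let F_0^(d) = F_{w_0}^(d), where w_0(0) = 1 and w_0(j) = 2^d − 1 for all j ≥ 1. For j ≥ 1 set x_j = ((2^j+1)/2^{j+1}, 2^{−(j+1)}, …, 2^{−(j+1)}) ∈ [0,1]^d. Then for every m ≥ 1 and every sign vector s ∈ {−1,1}^m there exists f ∈ F_0^(d) with f(x_j) = s_j for all j = 1,…,m. Consequently, the class F_0^(d) shatters arbitrarily large finite sets of points, i.e. it has infinite VC-dimension. -/

import Mathlib

open MeasureTheory Set
open scoped ENNReal

noncomputable section

/-- Points of `ℝ^d`. -/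
abbrev Pt (d : ℕ) : Type := Fin d → ℝ

/-- The unit cube `[0,1]^d`. -/
def unitCube (d : ℕ) : Set (Pt d) := Set.Icc 0 1

/-- Lebesgue measure `λ_d` on `[0,1]^d`. -/
def lamd (d : ℕ) : Measure (Pt d) := volume.restrict (unitCube d)

/-- The dyadic subinterval of `[0,1]` at level `j` with index `k`:
`[k 2^{-j}, (k+1) 2^{-j})` for `k < 2^j - 1` and `[1 - 2^{-j}, 1]` for `k = 2^j - 1`. -/
def dyadicI (j k : ℕ) : Set ℝ :=
  if k = 2 ^ j - 1 then Set.Icc (1 - ((2 : ℝ) ^ j)⁻¹) 1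
  else Set.Ico ((k : ℝ) / 2 ^ j) (((k : ℝ) + 1) / 2 ^ j)

/-- The dyadic cube `I_k^{(j)} ⊆ [0,1]^d` at level `j` with multi-index `k`. -/
def dyadicCube (d j : ℕ) (k : Fin d → ℕ) : Set (Pt d) :=
  {x | ∀ i, x i ∈ dyadicI j (k i)}

/-- `f` is represented by the (automatically countable) family `T` of pairwise disjoint
dyadic cubes whose union has full Lebesgue measure in `[0,1]^d`, with `f` constant
on each cube of the family. -/
def IsDyadicRep (d : ℕ) (f : Pt d → ℝ) (T : Set (ℕ × (Fin d → ℕ))) : Prop :=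
  (∀ p ∈ T, ∀ i, p.2 i < 2 ^ p.1) ∧
  (T.PairwiseDisjoint fun p => dyadicCube d p.1 p.2) ∧
  lamd d (unitCube d \ ⋃ p ∈ T, dyadicCube d p.1 p.2) = 0 ∧
  (∀ p ∈ T, ∀ x ∈ dyadicCube d p.1 p.2, ∀ y ∈ dyadicCube d p.1 p.2, f x = f y)

/-- The class `F^(d)` of measurable `{-1,1}`-valued functions admitting a dyadic
representation. -/
def memF (d : ℕ) (f : Pt d → ℝ) : Prop :=
  Measurable f ∧ (∀ x, f x = 1 ∨ f x = -1) ∧ ∃ T, IsDyadicRep d f T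

/-- The class `F_w^(d)`: a dyadic representation with at most `w j` cubes of side
`2^{-j}` for every level `j`. -/
def memFw (d : ℕ) (w : ℕ → ℝ) (f : Pt d → ℝ) : Prop :=
  Measurable f ∧ (∀ x, f x = 1 ∨ f x = -1) ∧
    ∃ T, IsDyadicRep d f T ∧
      ∀ j, ((T ∩ {p | p.1 = j}).encard : ℝ≥0∞) ≤ ENNReal.ofReal (w j)

/-- Marginal `P^X` of `π` on `[0,1]^d`. -/
def margX {d : ℕ} (π : Measure (Pt d × ℝ)) : Measure (Pt d) := π.map Prod.fst

/-- The labels of `π` lie in `{-1, 1}` almost surely. -/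
def Labels {d : ℕ} (π : Measure (Pt d × ℝ)) : Prop := π {p | p.2 = 1 ∨ p.2 = -1} = 1

/-- `η` is the regression function (conditional probability of `Y = 1`) of `π`. -/
def IsRegression {d : ℕ} (π : Measure (Pt d × ℝ)) (η : Pt d → ℝ) : Prop :=
  Measurable η ∧ (∀ x, η x ∈ Set.Icc (0 : ℝ) 1) ∧
    ∀ s : Set (Pt d), MeasurableSet s →
      π (s ×ˢ {(1 : ℝ)}) = ∫⁻ x in s, ENNReal.ofReal (η x) ∂(margX π)

/-- The Bayes rule `f*` associated with the regression function `η`. -/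
def bayes {d : ℕ} (η : Pt d → ℝ) (x : Pt d) : ℝ := if 1 / 2 ≤ η x then 1 else -1

/-- Misclassification risk `R(f) = π({(x,y) : f(x) ≠ y})`. -/
def risk {d : ℕ} (π : Measure (Pt d × ℝ)) (f : Pt d → ℝ) : ℝ :=
  (π {p | f p.1 ≠ p.2}).toReal

/-- Assumption (A1): `P^X` is absolutely continuous w.r.t. `λ_d` with density
between `a` and `A`. -/
def A1cond {d : ℕ} (π : Measure (Pt d × ℝ)) (a A : ℝ) : Prop :=
  ∀ s : Set (Pt d), MeasurableSet s →
    ENNReal.ofReal a * lamd d s ≤ margX π s ∧ margX π s ≤ ENNReal.ofReal A * lamd d s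

/-- Strong margin assumption (SMA) with margin `h`. -/
def SMAcond {d : ℕ} (π : Measure (Pt d × ℝ)) (η : Pt d → ℝ) (h : ℝ) : Prop :=
  margX π {x | h ≤ |2 * η x - 1|} = 1

/-- Number of indices `i` satisfying `P i`. -/
def cnt (n : ℕ) (P : Fin n → Prop) : ℕ := Nat.card {i // P i}

/-- Index of the level-`J` dyadic interval containing `t ∈ [0,1]`. -/
def dyadicIdx (J : ℕ) (t : ℝ) : ℕ := min ⌊t * 2 ^ J⌋₊ (2 ^ J - 1)

/-- The level-`J` dyadic cube containing `x ∈ [0,1]^d`. -/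
def cubeOf (d J : ℕ) (x : Pt d) : Set (Pt d) := dyadicCube d J fun i => dyadicIdx J (x i)

open Classical in
/-- The dyadic majority-vote classifier `f̂_n^{(J)}` built from the sample `s`. -/
def fhat (d J n : ℕ) (s : Fin n → Pt d × ℝ) (x : Pt d) : ℝ :=
  if (∃ i, (s i).1 ∈ cubeOf d J x) ∧
      cnt n (fun i => (s i).1 ∈ cubeOf d J x ∧ (s i).2 = -1) <
        cnt n (fun i => (s i).1 ∈ cubeOf d J x ∧ (s i).2 = 1)
  then 1 else -1

/-- The `n`-fold product measure `π^{⊗n}` governing the i.i.d. sample. -/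
def sampM {d : ℕ} (π : Measure (Pt d × ℝ)) [SigmaFinite π] (n : ℕ) :
    Measure (Fin n → Pt d × ℝ) := Measure.pi fun _ => π

/-- Expected excess risk `E_{π^{⊗n}}[R(f̂_n) - R(f*)]` of the classifier `F`. -/
def excessExp {d : ℕ} (π : Measure (Pt d × ℝ)) [SigmaFinite π] (η : Pt d → ℝ) (n : ℕ)
    (F : (Fin n → Pt d × ℝ) → Pt d → ℝ) : ℝ :=
  ∫ s, risk π (F s) ∂(sampM π n) - risk π (bayes η)

/-- The class `P_{w,h,a,A}` of probability measures (together with their regression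
functions) satisfying (A1), (SMA), and whose Bayes rule belongs to `F_w^(d)`. -/
def Pclass (d : ℕ) (w : ℕ → ℝ) (h a A : ℝ) :
    Set (ProbabilityMeasure (Pt d × ℝ) × (Pt d → ℝ)) :=
  {p | Labels (p.1 : Measure (Pt d × ℝ)) ∧ IsRegression (p.1 : Measure (Pt d × ℝ)) p.2 ∧
       A1cond (p.1 : Measure (Pt d × ℝ)) a A ∧ SMAcond (p.1 : Measure (Pt d × ℝ)) p.2 h ∧
       memFw d w (bayes p.2)}

end

theorem mem_dyadicI_iff {j k : ℕ} (hk : k < 2 ^ j) (t : ℝ) :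
    t ∈ dyadicI j k ↔ (0 ≤ t ∧ t ≤ 1) ∧ dyadicIdx j t = k := by
  have hpos : (0 : ℝ) < 2 ^ j := by positivity
  have hkR : (k : ℝ) + 1 ≤ 2 ^ j := by exact_mod_cast hk
  unfold dyadicI dyadicIdx
  split_ifs with h
  · have hkR' : (k : ℝ) + 1 = 2 ^ j := by
      have : k + 1 = 2 ^ j := by omega
      exact_mod_cast this
    have hl : 1 - ((2 : ℝ) ^ j)⁻¹ = k / 2 ^ j := by
      field_simp
      linarith
    rw [hl, mem_Icc, div_le_iff₀ hpos, ← h, min_eq_right_iff]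
    constructor
    · rintro ⟨h1, h2⟩
      have h0 : 0 ≤ t * 2 ^ j := le_trans (Nat.cast_nonneg k) h1
      exact ⟨⟨nonneg_of_mul_nonneg_left h0 hpos, h2⟩, Nat.le_floor h1⟩
    · rintro ⟨⟨h0, h1⟩, h2⟩
      exact ⟨(Nat.le_floor_iff (by positivity)).1 h2, h1⟩
  · rw [mem_Ico, div_le_iff₀ hpos, lt_div_iff₀ hpos]
    constructor
    · rintro ⟨h1, h2⟩
      have h0 : 0 ≤ t * 2 ^ j := le_trans (Nat.cast_nonneg k) h1
      refine ⟨⟨nonneg_of_mul_nonneg_left h0 hpos, ?_⟩, ?_⟩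
      · by_contra! ht
        nlinarith
      · rw [(Nat.floor_eq_iff h0).2 ⟨h1, h2⟩]
        omega
    · rintro ⟨⟨h0, h1⟩, h2⟩
      exact (Nat.floor_eq_iff (by positivity)).1 (by omega)

theorem mem_dyadicCube_iff {d j : ℕ} {k : Fin d → ℕ} (hk : ∀ i, k i < 2 ^ j) (x : Pt d) :
    x ∈ dyadicCube d j k ↔ x ∈ unitCube d ∧ ∀ i, dyadicIdx j (x i) = k i := by
  simp only [dyadicCube, mem_ofPred_eq, mem_dyadicI_iff (hk _), unitCube, mem_Icc, Pi.le_def,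
    Pi.zero_apply, Pi.one_apply, forall_and]

theorem dyadicIdx_succ_div_two (j : ℕ) (t : ℝ) : dyadicIdx (j + 1) t / 2 = dyadicIdx j t := by
  have h : ⌊t * 2 ^ j⌋₊ = ⌊t * 2 ^ (j + 1)⌋₊ / 2 := by
    rw [← Nat.floor_div_ofNat]
    congr 1
    rw [pow_succ]
    ring
  have hp : 0 < 2 ^ j := by positivity
  unfold dyadicIdx
  rw [h, pow_succ (2 : ℕ)]
  omega

theorem measurableSet_dyadicCube (d j : ℕ) (k : Fin d → ℕ) :
    MeasurableSet (dyadicCube d j k) := by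
  have h (i : Fin d) : MeasurableSet (dyadicI j (k i)) := by
    unfold dyadicI
    split_ifs
    · exact measurableSet_Icc
    · exact measurableSet_Ico
  simp only [dyadicCube, ofPred_forall]
  exact MeasurableSet.iInter fun i => measurable_pi_apply i (h i)

/-- Multi-index of the level-`n` dyadic cube that has `(1/2, 0, …, 0)` as its lowest corner
(the unit cube for `n = 0`). -/
def cornerIdx (d n : ℕ) (i : Fin d) : ℕ := if (i : ℕ) = 0 then 2 ^ n / 2 else 0

/-- The level-`n` dyadic cube with multi-index `cornerIdx d n`. -/
def cornerCube (d n : ℕ) : Set (Pt d) := dyadicCube d n (cornerIdx d n)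

/-- The dyadic partition consisting, at each level `n + 1`, of the children of `cornerCube d n`
other than `cornerCube d (n + 1)`. -/
def cornerPartition (d : ℕ) : Set (ℕ × (Fin d → ℕ)) :=
  {p | ∃ n, p.1 = n + 1 ∧ (∀ i, p.2 i / 2 = cornerIdx d n i) ∧ p.2 ≠ cornerIdx d (n + 1)}

theorem cornerIdx_lt (d n : ℕ) (i : Fin d) : cornerIdx d n i < 2 ^ n := by
  have hp : 0 < 2 ^ n := by positivity
  unfold cornerIdx
  split_ifs <;> omega

theorem cornerIdx_succ_div_two (d n : ℕ) (i : Fin d) :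
    cornerIdx d (n + 1) i / 2 = cornerIdx d n i := by
  unfold cornerIdx
  split_ifs
  · rw [pow_succ]
    omega
  · rfl

theorem mem_cornerCube_iff {d n : ℕ} {x : Pt d} :
    x ∈ cornerCube d n ↔ x ∈ unitCube d ∧ ∀ i, dyadicIdx n (x i) = cornerIdx d n i :=
  mem_dyadicCube_iff (cornerIdx_lt d n) x

theorem cornerCube_zero (d : ℕ) : cornerCube d 0 = unitCube d := by
  ext x
  simp [mem_cornerCube_iff, dyadicIdx, cornerIdx]

theorem antitone_cornerCube (d : ℕ) : Antitone (cornerCube d) := by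
  refine antitone_nat_of_succ_le fun n x hx => ?_
  rw [mem_cornerCube_iff] at hx ⊢
  refine ⟨hx.1, fun i => ?_⟩
  rw [← dyadicIdx_succ_div_two, hx.2, cornerIdx_succ_div_two]

theorem eq_of_mem_cornerCube_diff {d a b : ℕ} {x : Pt d}
    (ha : x ∈ cornerCube d a \ cornerCube d (a + 1))
    (hb : x ∈ cornerCube d b \ cornerCube d (b + 1)) : a = b := by
  by_contra hne
  rcases Nat.lt_or_gt_of_ne hne with h | h
  · exact ha.2 (antitone_cornerCube d h hb.1)
  · exact hb.2 (antitone_cornerCube d h ha.1)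

theorem cornerPartition_lt {d : ℕ} {p : ℕ × (Fin d → ℕ)} (hp : p ∈ cornerPartition d)
    (i : Fin d) : p.2 i < 2 ^ p.1 := by
  obtain ⟨n, h1, h2, -⟩ := hp
  have := cornerIdx_lt d n i
  rw [h1, pow_succ]
  have := h2 i
  omega

theorem subset_cornerCube_diff {d n : ℕ} {k : Fin d → ℕ} (hp : (n + 1, k) ∈ cornerPartition d) :
    dyadicCube d (n + 1) k ⊆ cornerCube d n \ cornerCube d (n + 1) := by
  intro x hx
  rw [mem_dyadicCube_iff (cornerPartition_lt hp)] at hx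
  obtain ⟨n', h1, h2, h3⟩ := hp
  obtain rfl : n = n' := by simpa using h1
  rw [mem_sdiff, mem_cornerCube_iff, mem_cornerCube_iff]
  refine ⟨⟨hx.1, fun i => ?_⟩, fun h => h3 ?_⟩
  · rw [← dyadicIdx_succ_div_two, hx.2, h2]
  · funext i
    rw [← h.2 i, hx.2 i]

theorem pairwiseDisjoint_cornerPartition (d : ℕ) :
    (cornerPartition d).PairwiseDisjoint fun p => dyadicCube d p.1 p.2 := by
  rintro ⟨a, k⟩ hp ⟨b, l⟩ hq hne
  refine Set.disjoint_left.2 fun x hx hy => hne ?_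
  obtain ⟨a, rfl, -⟩ := id hp
  obtain ⟨b, rfl, -⟩ := id hq
  obtain rfl := eq_of_mem_cornerCube_diff (subset_cornerCube_diff hp hx)
    (subset_cornerCube_diff hq hy)
  have h1 := ((mem_dyadicCube_iff (cornerPartition_lt hp) x).1 hx).2
  have h2 := ((mem_dyadicCube_iff (cornerPartition_lt hq) x).1 hy).2
  congr 1
  funext i
  exact (h1 i).symm.trans (h2 i)

theorem apply_zero_eq_half_of_forall_mem_cornerCube {d : ℕ} {x : Pt d}
    (hx : ∀ n, x ∈ cornerCube d n) {i : Fin d} (hi : (i : ℕ) = 0) : x i = 1 / 2 := by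
  have key (n : ℕ) : |x i - 1 / 2| ≤ (1 / 2) ^ n := by
    have hn := mem_cornerCube_iff.1 (hx (n + 2))
    have h0 : 0 ≤ x i := hn.1.1 i
    have hfl := hn.2 i
    have hp : 0 < 2 ^ n := by positivity
    simp only [dyadicIdx, cornerIdx, hi, if_true] at hfl
    have hfl' : ⌊x i * 2 ^ (n + 2)⌋₊ = 2 * 2 ^ n := by
      have hp' : 2 ^ (n + 2) = 2 ^ n * 4 := pow_add 2 n 2
      omega
    rw [Nat.floor_eq_iff (by positivity)] at hfl'
    push_cast at hfl'
    obtain ⟨h1, h2⟩ := hfl'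
    have hpR : (0 : ℝ) < 2 ^ n := by positivity
    rw [pow_add] at h1 h2
    have habs : |x i - 1 / 2| * 2 ^ n = |(x i - 1 / 2) * 2 ^ n| := by
      rw [abs_mul, abs_of_pos hpR]
    rw [one_div_pow, le_div_iff₀ hpR, habs, abs_le]
    constructor <;> linarith
  have hlim := ge_of_tendsto'
    (tendsto_pow_atTop_nhds_zero_of_lt_one (by norm_num : (0 : ℝ) ≤ 1 / 2) (by norm_num)) key
  have := abs_nonpos_iff.1 hlim
  linarith

theorem lamd_compl_cornerPartition {d : ℕ} (hd : 1 ≤ d) :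
    lamd d (unitCube d \ ⋃ p ∈ cornerPartition d, dyadicCube d p.1 p.2) = 0 := by
  let i₀ : Fin d := ⟨0, hd⟩
  have hsub : unitCube d \ ⋃ p ∈ cornerPartition d, dyadicCube d p.1 p.2 ⊆
      {x | x i₀ = 1 / 2} := by
    rintro x ⟨hx, hnot⟩
    refine apply_zero_eq_half_of_forall_mem_cornerCube (fun n => ?_) rfl
    induction n with
    | zero => rwa [cornerCube_zero]
    | succ n ih =>
      by_contra hc
      refine hnot (mem_biUnion (x := (n + 1, fun i => dyadicIdx (n + 1) (x i)))
        ⟨n, rfl, fun i => ?_, fun h => hc ?_⟩ ?_)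
      · rw [dyadicIdx_succ_div_two, (mem_cornerCube_iff.1 ih).2]
      · exact mem_cornerCube_iff.2 ⟨hx, congrFun h⟩
      · refine (mem_dyadicCube_iff (fun i => ?_) x).2 ⟨hx, fun i => rfl⟩
        have hp : 0 < 2 ^ (n + 1) := by positivity
        exact (min_le_right _ _).trans_lt (Nat.sub_lt hp one_pos)
  have hnull : (volume : Measure (Pt d)) {x | x i₀ = 1 / 2} = 0 :=
    Measure.pi_hyperplane (fun _ => volume) i₀ (1 / 2)
  exact Measure.restrict_le_self.absolutelyContinuous (measure_mono_null hsub hnull)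

theorem encard_cornerPartition_level_le (d n : ℕ) :
    (cornerPartition d ∩ {p | p.1 = n + 1}).encard ≤ (2 ^ d - 1 : ℕ) := by
  let S : Finset (Fin d → ℕ) :=
    Fintype.piFinset fun i => {2 * cornerIdx d n i, 2 * cornerIdx d n i + 1}
  have hS (k : Fin d → ℕ) : k ∈ S ↔ ∀ i, k i / 2 = cornerIdx d n i := by
    simp only [S, Fintype.mem_piFinset, Finset.mem_insert, Finset.mem_singleton]
    exact forall_congr' fun i => by omega
  have hcard : (S.erase (cornerIdx d (n + 1))).card = 2 ^ d - 1 := by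
    rw [Finset.card_erase_of_mem ((hS _).2 (cornerIdx_succ_div_two d n))]
    simp [S, Fintype.card_piFinset]
  have hsub : cornerPartition d ∩ {p | p.1 = n + 1} ⊆
      (fun k => (n + 1, k)) '' (S.erase (cornerIdx d (n + 1)) : Set (Fin d → ℕ)) := by
    rintro ⟨a, k⟩ ⟨⟨n', h1, h2, h3⟩, h4⟩
    obtain rfl : a = n + 1 := h4
    obtain rfl : n = n' := by simpa using h1
    exact ⟨k, Finset.mem_coe.2 (Finset.mem_erase.2 ⟨h3, (hS k).2 h2⟩), rfl⟩
  calc _ ≤ _ := encard_le_encard hsub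
    _ ≤ _ := encard_image_le _ _
    _ = _ := by rw [encard_coe_eq_coe_finsetCard, hcard]

open Classical in
/-- The classifier equal to `-1` exactly on the shells
`cornerCube d (n + 1) \ cornerCube d (n + 2)` with `n ∈ N`. -/
noncomputable def shellClassifier (d : ℕ) (N : Set ℕ) (x : Pt d) : ℝ :=
  if ∃ n ∈ N, x ∈ cornerCube d (n + 1) \ cornerCube d (n + 2) then -1 else 1

theorem shellClassifier_of_mem {d n : ℕ} {N : Set ℕ} {x : Pt d}
    (hx : x ∈ cornerCube d n \ cornerCube d (n + 1)) [Decidable (∃ a ∈ N, a + 1 = n)] :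
    shellClassifier d N x = if ∃ a ∈ N, a + 1 = n then -1 else 1 := by
  have : (∃ a ∈ N, x ∈ cornerCube d (a + 1) \ cornerCube d (a + 2)) ↔ ∃ a ∈ N, a + 1 = n := by
    refine exists_congr fun a => and_congr_right fun _ => ⟨fun h => ?_, ?_⟩
    · exact eq_of_mem_cornerCube_diff h hx
    · rintro rfl
      exact hx
  simp only [shellClassifier, this]

theorem measurable_shellClassifier (d : ℕ) (N : Set ℕ) : Measurable (shellClassifier d N) := by
  refine Measurable.ite ?_ measurable_const measurable_const
  have : {x : Pt d | ∃ n ∈ N, x ∈ cornerCube d (n + 1) \ cornerCube d (n + 2)} =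
      ⋃ n ∈ N, cornerCube d (n + 1) \ cornerCube d (n + 2) := by
    ext x
    simp only [mem_ofPred_eq, mem_iUnion, exists_prop]
  rw [this]
  exact MeasurableSet.biUnion N.to_countable fun n _ =>
    (measurableSet_dyadicCube _ _ _).diff (measurableSet_dyadicCube _ _ _)

theorem isDyadicRep_shellClassifier {d : ℕ} (hd : 1 ≤ d) (N : Set ℕ) :
    IsDyadicRep d (shellClassifier d N) (cornerPartition d) := by
  classical
  refine ⟨fun p hp => cornerPartition_lt hp, pairwiseDisjoint_cornerPartition d,
    lamd_compl_cornerPartition hd, ?_⟩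
  rintro ⟨a, k⟩ hp x hx y hy
  obtain ⟨n, rfl, -⟩ := id hp
  rw [shellClassifier_of_mem (subset_cornerCube_diff hp hx),
    shellClassifier_of_mem (subset_cornerCube_diff hp hy)]

theorem mem_cornerCube_diff_of_center {d n : ℕ} (hd : 1 ≤ d) (hn : 1 ≤ n) {x : Pt d}
    (hx : ∀ i : Fin d,
      x i = if (i : ℕ) = 0 then ((2 : ℝ) ^ n + 1) / 2 ^ (n + 1) else 1 / 2 ^ (n + 1)) :
    x ∈ cornerCube d n \ cornerCube d (n + 1) := by
  have hp : 2 ≤ 2 ^ n := Nat.le_self_pow (by omega) 2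
  have hpR : (2 : ℝ) ≤ 2 ^ n := by exact_mod_cast hp
  have hidx (i : Fin d) :
      dyadicIdx (n + 1) (x i) = if (i : ℕ) = 0 then 2 ^ n + 1 else 1 := by
    unfold dyadicIdx
    rw [hx]
    split_ifs
    · rw [div_mul_cancel₀ _ (by positivity)]
      have : ⌊(2 : ℝ) ^ n + 1⌋₊ = 2 ^ n + 1 := by
        exact_mod_cast Nat.floor_natCast (R := ℝ) (2 ^ n + 1)
      rw [this, pow_succ]
      omega
    · rw [div_mul_cancel₀ _ (by positivity), Nat.floor_one, pow_succ]
      omega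
  rw [mem_sdiff, mem_cornerCube_iff, mem_cornerCube_iff]
  refine ⟨⟨⟨fun i => ?_, fun i => ?_⟩, fun i => ?_⟩, fun h => ?_⟩
  · rw [hx]
    simp only [Pi.zero_apply]
    split_ifs <;> positivity
  · rw [hx]
    simp only [Pi.one_apply]
    split_ifs <;> rw [div_le_one (by positivity), pow_succ] <;> linarith
  · rw [← dyadicIdx_succ_div_two, hidx]
    obtain ⟨n, rfl⟩ : ∃ l, n = l + 1 := ⟨n - 1, by omega⟩
    unfold cornerIdx
    split_ifs
    · rw [pow_succ]
      omega
    · rfl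
  · have := h.2 ⟨0, hd⟩
    rw [hidx] at this
    simp only [cornerIdx, if_true, pow_succ] at this
    omega

/-- The minimal class `F_0^(d)` shatters the points
`x_j = ((2^j+1)/2^{j+1}, 2^{-(j+1)}, …, 2^{-(j+1)})`, `j = 1, …, m`, for every `m`;
hence it has infinite VC-dimension. -/
theorem F0_shatters (d : ℕ) (hd : 1 ≤ d) (w₀ : ℕ → ℝ) (hw₀0 : w₀ 0 = 1)
    (hw₀ : ∀ j, 1 ≤ j → w₀ j = 2 ^ d - 1)
    (xpt : ℕ → Pt d)
    (hxpt : ∀ j (i : Fin d),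
      xpt j i = if (i : ℕ) = 0 then ((2 : ℝ) ^ j + 1) / 2 ^ (j + 1) else 1 / 2 ^ (j + 1))
    (m : ℕ) (hm : 1 ≤ m) (s : Fin m → ℝ) (hs : ∀ i, s i = 1 ∨ s i = -1) :
    ∃ f, memFw d w₀ f ∧ ∀ j : Fin m, f (xpt ((j : ℕ) + 1)) = s j := by
  classical
  let N : Set ℕ := {n | ∃ h : n < m, s ⟨n, h⟩ = -1}
  refine ⟨shellClassifier d N, ⟨measurable_shellClassifier d N, fun x => ?_, cornerPartition d,
    isDyadicRep_shellClassifier hd N, fun j => ?_⟩, fun j => ?_⟩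
  · unfold shellClassifier
    split_ifs <;> simp
  · rcases j with _ | n
    · have : cornerPartition d ∩ {p | p.1 = 0} = ∅ := by
        ext p
        simp only [cornerPartition, mem_inter_iff, mem_ofPred_eq, mem_empty_iff_false, iff_false]
        rintro ⟨⟨n, h, -⟩, h0⟩
        omega
      simp [this]
    · have hw : w₀ (n + 1) = ((2 ^ d - 1 : ℕ) : ℝ) := by
        rw [hw₀ _ (by omega), Nat.cast_sub Nat.one_le_two_pow]
        simp
      rw [hw, ENNReal.ofReal_natCast]
      exact_mod_cast ENat.toENNReal_le.2 (encard_cornerPartition_level_le d n)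
  · rw [shellClassifier_of_mem (mem_cornerCube_diff_of_center hd (by omega) (hxpt _))]
    have : (∃ a ∈ N, a + 1 = (j : ℕ) + 1) ↔ s j = -1 := by simp [N]
    simp only [this]
    split_ifs with h
    · exact h.symm
    · exact ((hs j).resolve_right h).symm
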